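/- Fix d > 0. For all sufficiently large n there exists a deterministic non-prefix d-semifaithful code (φ_n, f_n, g_n) in the universal distortion setting such that, uniformly over all p ∈ P(A) and ρ ∈ D, (1/n)·E_p[ ln(2)· l(f_n(φ_n(X^n, ρ))) ] − E_p[R(T,d,ρ)] ≤ (2ρ_max ln n)/(d·n^{5/8}) + 4ρ_max(min(ln K, ln J) + ln 2)/(d·n^{5/8}) + ((K + 5/4)/2)·(ln n)/n + γ_n·(ln ln n)/n + O(1/n), where γ_n = 1 + ln(J²K² + J − 1)/ln ln n and the O(1/n) term depends only on J and K. -/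

import Mathlib

open Filter MeasureTheory
open scoped BigOperators

noncomputable section

variable {A B : Type*}

/-- `p` is a probability distribution on the finite alphabet `A`. -/
def IsProb [Fintype A] (p : A → ℝ) : Prop :=
  (∀ a, 0 ≤ p a) ∧ ∑ a, p a = 1

/-- `Q` is a conditional probability distribution from `A` to `B`. -/
def IsCondProb [Fintype A] [Fintype B] (Q : A → B → ℝ) : Prop :=
  ∀ j, IsProb (Q j)

/-- `ρ` is a distortion measure in the class `D`: bounded in `[0, ρmax]` and
with `max_j min_k ρ(j,k) = 0` (equivalently, every row contains a zero). -/
def IsDistMeasure [Fintype A] [Fintype B] (ρmax : ℝ) (ρ : A → B → ℝ) : Prop :=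
  (∀ j k, 0 ≤ ρ j k ∧ ρ j k ≤ ρmax) ∧ ∀ j, ∃ k, ρ j k = 0

/-- Mutual information `I(p, Q)` in nats. -/
def mutualInfo [Fintype A] [Fintype B] (p : A → ℝ) (Q : A → B → ℝ) : ℝ :=
  ∑ j, ∑ k, p j * Q j k * Real.log (Q j k / ∑ j', p j' * Q j' k)

/-- Average distortion `Σ_{j,k} p(j) Q(k|j) ρ(j,k)`. -/
def avgDist [Fintype A] [Fintype B] (p : A → ℝ) (Q : A → B → ℝ) (ρ : A → B → ℝ) : ℝ :=
  ∑ j, ∑ k, p j * Q j k * ρ j k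

/-- The rate-distortion function `R(p,d,ρ)` in nats. -/
def RD [Fintype A] [Fintype B] (p : A → ℝ) (d : ℝ) (ρ : A → B → ℝ) : ℝ :=
  sInf { r | ∃ Q, IsCondProb Q ∧ avgDist p Q ρ ≤ d ∧ r = mutualInfo p Q }

/-- The type (empirical distribution) of a sequence `x ∈ A^n`. -/
def typeOf [DecidableEq A] {n : ℕ} (x : Fin n → A) : A → ℝ :=
  fun a => ((Finset.univ.filter fun i => x i = a).card : ℝ) / n

/-- The i.i.d. product probability `p^n(x) = ∏ i p(x_i)`. -/
def prodProb {n : ℕ} (p : A → ℝ) (x : Fin n → A) : ℝ :=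
  ∏ i, p (x i)

/-- The `n`-fold single-letter distortion `ρ_n(x,y) = (1/n) Σ_i ρ(x_i, y_i)`. -/
def nDist {n : ℕ} (ρ : A → B → ℝ) (x : Fin n → A) (y : Fin n → B) : ℝ :=
  (∑ i, ρ (x i) (y i)) / n

/-- `E_p[R(T,d,ρ)]`, the expectation of the empirical rate-distortion function
over `X^n` i.i.d. `p` (written as a sum over sequences). -/
def expTypeRD [Fintype A] [DecidableEq A] [Fintype B] (n : ℕ) (p : A → ℝ)
    (d : ℝ) (ρ : A → B → ℝ) : ℝ :=
  ∑ x : Fin n → A, prodProb p x * RD (typeOf x) d ρ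

/-- number of occurrences of `a` in the sequence `f`. -/
def cnt {α : Type*} [DecidableEq α] {n : ℕ} (f : Fin n → α) (a : α) : ℕ :=
  (Finset.univ.filter fun i => f i = a).card

lemma sum_cnt {α : Type*} [DecidableEq α] [Fintype α] {n : ℕ} (f : Fin n → α) :
    ∑ a, cnt f a = n := by
  have := Finset.card_eq_sum_card_fiberwise (f := f) (s := Finset.univ) (t := Finset.univ)
    (fun _ _ => by simp)
  simpa [cnt] using this.symm

lemma stab_card {α : Type*} [DecidableEq α] [Fintype α] {n : ℕ} (f : Fin n → α) :
    (Finset.univ.filter fun g : Equiv.Perm (Fin n) => f ∘ g = f).card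
      = ∏ a, (cnt f a).factorial := by
  rw [← Fintype.card_subtype, DomMulAct.stabilizer_card]
  refine Finset.prod_congr rfl fun a _ => ?_
  rw [Fintype.card_subtype]; rfl

lemma cnt_comp_perm {α : Type*} [DecidableEq α] {n : ℕ} (f : Fin n → α)
    (g : Equiv.Perm (Fin n)) (a : α) : cnt (f ∘ g) a = cnt f a := by
  unfold cnt
  refine Finset.card_bij (fun i _ => g i) ?_ ?_ ?_
  · intro i hi; simpa using hi
  · intro i _ j _ h; exact g.injective h
  · intro b hb; exact ⟨g.symm b, by simpa using hb, by simp⟩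

/-- joint word -/
def jw {α β : Type*} {n : ℕ} (x : Fin n → α) (y : Fin n → β) : Fin n → α × β :=
  fun i => (x i, y i)

lemma shell_card {α β : Type*} [DecidableEq α] [Fintype α] [DecidableEq β] [Fintype β] {n : ℕ}
    (x : Fin n → α) (y : Fin n → β) :
    ∏ a, (cnt x a).factorial ≤ (∏ c, (cnt (jw x y) c).factorial) *
      (Finset.univ.filter fun y' : Fin n → β => ∀ c, cnt (jw x y') c = cnt (jw x y) c).card := by
  rw [← stab_card, ← stab_card]
  refine Finset.card_le_mul_card_image_of_maps_to (f := fun g : Equiv.Perm (Fin n) => y ∘ g) ?_ _ ?_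
  · intro g hg
    simp only [Finset.mem_filter, Finset.mem_univ, true_and] at hg ⊢
    intro c
    have : jw x (y ∘ g) = jw x y ∘ g := by
      funext i
      have := congrFun hg i
      simp only [Function.comp] at this
      simp [jw, this]
    rw [this, cnt_comp_perm]
  · intro y' _
    rcases (Finset.filter (fun g : Equiv.Perm (Fin n) => y ∘ g = y')
      (Finset.univ.filter fun g : Equiv.Perm (Fin n) => x ∘ g = x)).eq_empty_or_nonempty with h | ⟨g0, hg0⟩
    · rw [h]; simp
    · refine Finset.card_le_card_of_injOn (fun g => g * g0⁻¹) ?_ ?_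
      · intro g hg
        simp only [Finset.coe_filter, Finset.mem_filter, Finset.mem_univ, true_and, Set.mem_ofPred_eq] at hg hg0 ⊢
        funext i
        have h1 := congrFun hg.1 (g0⁻¹ i)
        have h2 := congrFun hg0.1 (g0⁻¹ i)
        have h3 := congrFun (hg.2.trans hg0.2.symm) (g0⁻¹ i)
        have h4 : g0 (g0⁻¹ i) = i := by simp
        simp only [Function.comp, h4] at h1 h2 h3
        show (x (g (g0⁻¹ i)), y (g (g0⁻¹ i))) = (x i, y i)
        rw [h1, ← h2, h3]
      · intro a _ b _ h
        exact mul_right_cancel h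

lemma exists_shell {α β : Type*} [DecidableEq α] [DecidableEq β] [Fintype β] {n : ℕ}
    (x : Fin n → α) (V : α → β → ℕ) (hV : ∀ j, ∑ k, V j k = cnt x j) :
    ∃ y : Fin n → β, ∀ j k, cnt (jw x y) (j, k) = V j k := by
  have e : ∀ j, Nonempty ({i // x i = j} ≃ (Σ k, Fin (V j k))) := by
    intro j
    refine ⟨Fintype.equivOfCardEq ?_⟩
    rw [Fintype.card_sigma, Fintype.card_subtype]
    simpa [cnt] using (hV j).symm
  replace e := fun j => (e j).some
  refine ⟨fun i => (e (x i) ⟨i, rfl⟩).1, fun j k => ?_⟩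
  rw [cnt, ← Fintype.card_subtype]
  have key : {i // jw x (fun i => (e (x i) ⟨i, rfl⟩).1) i = (j, k)} ≃ Fin (V j k) := by
    refine Equiv.trans (β := {s : (Σ k, Fin (V j k)) // s.1 = k}) ?_ ?_
    · refine Equiv.trans (β := {s : {i // x i = j} // (e j s).1 = k}) ?_ ?_
      · refine ⟨fun i => ⟨⟨i.1, (Prod.ext_iff.1 i.2).1⟩, ?_⟩, fun s => ⟨s.1.1, ?_⟩, ?_, ?_⟩
        · obtain ⟨i, hi⟩ := i
          obtain ⟨h1, h2⟩ := Prod.ext_iff.1 hi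
          simp only [jw] at h1 h2
          subst h1
          exact h2
        · obtain ⟨⟨i, rfl⟩, hi⟩ := s
          simpa [jw] using hi
        · intro i; rfl
        · intro s; rfl
      · exact (e j).subtypeEquiv (fun s => Iff.rfl)
    · exact Equiv.sigmaSubtype k
  rw [Fintype.card_congr key, Fintype.card_fin]

lemma type_card {β : Type*} [DecidableEq β] [Fintype β] {n : ℕ} (s : β → ℕ) (hs : ∑ k, s k = n) :
    (Finset.univ.filter fun y : Fin n → β => ∀ k, cnt y k = s k).card * ∏ k, s k ^ s k ≤ n ^ n := by
  have h1 : ∑ y : Fin n → β, ∏ i, s (y i) = n ^ n := by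
    have h := Finset.prod_univ_sum (fun _ : Fin n => (Finset.univ : Finset β)) (fun _ k => s k)
    rw [Finset.prod_const, hs, Finset.card_univ, Fintype.card_fin, Fintype.piFinset_univ] at h
    exact h.symm
  rw [← h1]
  refine le_trans ?_ (Finset.sum_le_sum_of_subset (Finset.filter_subset
    (fun y : Fin n → β => ∀ k, cnt y k = s k) _))
  rw [← smul_eq_mul, ← Finset.sum_const]
  refine Finset.sum_le_sum fun y hy => le_of_eq ?_
  simp only [Finset.mem_filter, Finset.mem_univ, true_and] at hy
  rw [← Finset.prod_fiberwise' Finset.univ y s]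
  refine Finset.prod_congr rfl fun k _ => ?_
  rw [Finset.prod_const, ← hy k]; rfl

lemma covering {α β : Type*} [DecidableEq β] (X : Finset α) (Ω : Finset β)
    (S : α → Finset β) (D M : ℕ) (hS : ∀ a ∈ X, S a ⊆ Ω) (hD : ∀ a ∈ X, D ≤ (S a).card)
    (hM : X.card * (Ω.card - D) ^ M < Ω.card ^ M) :
    ∃ c : Fin M → β, ∀ a ∈ X, ∃ i, c i ∈ S a := by
  classical
  by_contra! hc
  have hsub : Fintype.piFinset (fun _ : Fin M => Ω) ⊆
      X.biUnion fun a => Fintype.piFinset (fun _ : Fin M => Ω \ S a) := by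
    intro c h
    obtain ⟨a, ha, h2⟩ := hc c
    rw [Finset.mem_biUnion]
    refine ⟨a, ha, ?_⟩
    rw [Fintype.mem_piFinset] at h ⊢
    intro i
    exact Finset.mem_sdiff.2 ⟨h i, h2 i⟩
  have h1 := Finset.card_le_card hsub
  have h2 := h1.trans Finset.card_biUnion_le
  have h3 : ∑ a ∈ X, (Fintype.piFinset (fun _ : Fin M => Ω \ S a)).card
      ≤ ∑ a ∈ X, (Ω.card - D) ^ M := by
    refine Finset.sum_le_sum fun a ha => ?_
    rw [Fintype.card_piFinset, Finset.prod_const, Finset.card_univ, Fintype.card_fin]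
    refine Nat.pow_le_pow_left ?_ M
    rw [Finset.card_sdiff_of_subset (hS a ha)]
    have := hD a ha
    omega
  have h4 := h2.trans h3
  rw [Fintype.card_piFinset, Finset.prod_const, Finset.card_univ, Fintype.card_fin,
    Finset.sum_const, smul_eq_mul] at h4
  omega

lemma log_fact_lower (m : ℕ) : (m : ℝ) * Real.log m - m ≤ Real.log (m.factorial) := by
  rcases Nat.eq_zero_or_pos m with rfl | hm
  · simp
  have hm' : (0 : ℝ) < m := by exact_mod_cast hm
  have h : (m : ℝ) ^ m / m.factorial ≤ Real.exp m := Real.pow_div_factorial_le_exp _ hm'.le _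
  have hf : (0 : ℝ) < m.factorial := by exact_mod_cast m.factorial_pos
  have := Real.log_le_log (by positivity) h
  rw [Real.log_div (by positivity) (by positivity), Real.log_pow, Real.log_exp] at this
  linarith

lemma log_fact_upper (m : ℕ) :
    Real.log (m.factorial) ≤ (m : ℝ) * Real.log m - m + 2 * Real.log (m + 1) + 1 := by
  induction m with
  | zero => simp
  | succ m ih =>
    have hf : (0 : ℝ) < m.factorial := by exact_mod_cast m.factorial_pos
    rw [Nat.factorial_succ]
    push_cast
    rw [Real.log_mul (by positivity) (by positivity)]
    have h2 : Real.log (((m : ℝ) + 1) / (m + 2)) ≤ ((m : ℝ) + 1) / (m + 2) - 1 :=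
      Real.log_le_sub_one_of_pos (by positivity)
    rw [Real.log_div (by positivity) (by positivity)] at h2
    have e2 : ((m : ℝ) + 1) / (m + 2) - 1 = - (1 / (m + 2)) := by field_simp; ring
    have h1 : (m : ℝ) * Real.log m ≤ m * Real.log (m + 1) - m / (m + 1) := by
      rcases Nat.eq_zero_or_pos m with rfl | hm
      · simp
      have hm' : (0 : ℝ) < m := by exact_mod_cast hm
      have h : Real.log ((m : ℝ) / (m + 1)) ≤ (m : ℝ) / (m + 1) - 1 :=
        Real.log_le_sub_one_of_pos (by positivity)
      rw [Real.log_div (by positivity) (by positivity)] at h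
      have e : (m : ℝ) / (m + 1) - 1 = - (1 / (m + 1)) := by field_simp; ring
      have := mul_le_mul_of_nonneg_left h hm'.le
      rw [e] at this
      have e3 : (m : ℝ) / (m + 1) = m * (1 / (m + 1)) := by ring
      rw [e3]; linarith
    have h3 : 1 / ((m : ℝ) + 1) ≤ 2 * (1 / (m + 2)) := by
      rw [mul_one_div, div_le_div_iff₀ (by positivity) (by positivity)]
      have : (0 : ℝ) ≤ m := by positivity
      linarith
    have e4 : (m : ℝ) / (m + 1) = 1 - 1 / (m + 1) := by field_simp; ring
    have e5 : (m : ℝ) + 1 + 1 = m + 2 := by ring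
    rw [e5]
    rw [e2] at h2
    rw [e4] at h1
    linarith

/-- `n` times the mutual information of a (real) count matrix. -/
def FF {J K : ℕ} (n : ℕ) (V : Fin J → Fin K → ℝ) : ℝ :=
  n * Real.log n + ∑ j, ∑ k, V j k * Real.log (V j k)
    - ∑ j, (∑ k, V j k) * Real.log (∑ k, V j k)
    - ∑ k, (∑ j, V j k) * Real.log (∑ j, V j k)

lemma cnt_jw_fst {α β : Type*} [DecidableEq α] [DecidableEq β] [Fintype β] {n : ℕ}
    (x : Fin n → α) (y : Fin n → β) (j : α) : ∑ k, cnt (jw x y) (j, k) = cnt x j := by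
  have := Finset.card_eq_sum_card_fiberwise (f := y) (s := Finset.univ.filter fun i => x i = j)
    (t := Finset.univ) (fun _ _ => by simp)
  unfold cnt
  rw [this]
  refine Finset.sum_congr rfl fun k _ => ?_
  rw [Finset.filter_filter]
  simp [jw]

lemma cnt_jw_snd {α β : Type*} [DecidableEq α] [DecidableEq β] [Fintype α] {n : ℕ}
    (x : Fin n → α) (y : Fin n → β) (k : β) : ∑ j, cnt (jw x y) (j, k) = cnt y k := by
  have := Finset.card_eq_sum_card_fiberwise (f := x) (s := Finset.univ.filter fun i => y i = k)
    (t := Finset.univ) (fun _ _ => by simp)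
  unfold cnt
  rw [this]
  refine Finset.sum_congr rfl fun j _ => ?_
  rw [Finset.filter_filter]
  simp [jw, and_comm]

lemma cover_V {J K n : ℕ} (hn : 0 < n) (V : Fin J → Fin K → ℕ)
    (x0 : Fin n → Fin J) (hx0 : ∀ j, ∑ k, V j k = cnt x0 j) :
    ∃ M : ℕ, ∃ c : Fin M → (Fin n → Fin K),
      (∀ x : Fin n → Fin J, (∀ j, ∑ k, V j k = cnt x j) →
        ∃ i, ∀ j k, cnt (jw x (c i)) (j, k) = V j k) ∧
      Real.log M ≤ FF n (fun j k => (V j k : ℝ)) + J * K * (2 * Real.log (n + 1) + 1)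
        + Real.log (n * J + 2) := by
  classical
  have hsum : ∑ j, ∑ k, V j k = n := by
    rw [Finset.sum_congr rfl (fun j _ => hx0 j), sum_cnt]
  set s : Fin K → ℕ := fun k => ∑ j, V j k with hs
  set t : Fin J → ℕ := fun j => ∑ k, V j k with ht
  have hssum : ∑ k, s k = n := by rw [hs, Finset.sum_comm]; exact hsum
  set Ω : Finset (Fin n → Fin K) := Finset.univ.filter fun y => ∀ k, cnt y k = s k with hΩ
  set X : Finset (Fin n → Fin J) := Finset.univ.filter fun x => ∀ j, t j = cnt x j with hX
  set S : (Fin n → Fin J) → Finset (Fin n → Fin K) :=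
    fun x => Finset.univ.filter fun y => ∀ j k, cnt (jw x y) (j, k) = V j k with hS
  have hSΩ : ∀ x ∈ X, S x ⊆ Ω := by
    intro x _ y hy
    simp only [hS, hΩ, hs, Finset.mem_filter, Finset.mem_univ, true_and] at hy ⊢
    intro k
    rw [← cnt_jw_snd x y k]
    exact Finset.sum_congr rfl fun j _ => hy j k
  set PV : ℕ := ∏ j, ∏ k, (V j k).factorial with hPV
  set PT : ℕ := ∏ j, (t j).factorial with hPT
  have hPV0 : 0 < PV := Finset.prod_pos fun j _ => Finset.prod_pos fun k _ => Nat.factorial_pos _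
  have hPT0 : 0 < PT := Finset.prod_pos fun j _ => Nat.factorial_pos _
  have hPV' : (0 : ℝ) < PV := by exact_mod_cast hPV0
  have hPT' : (0 : ℝ) < PT := by exact_mod_cast hPT0
  have hScard : ∀ x ∈ X, (PT : ℝ) / PV ≤ (S x).card := by
    intro x hx
    simp only [hX, Finset.mem_filter, Finset.mem_univ, true_and] at hx
    obtain ⟨y, hy⟩ := exists_shell x V hx
    have h := shell_card x y
    have e1 : ∏ a, (cnt x a).factorial = PT :=
      Finset.prod_congr rfl fun j _ => by rw [hx j]
    have e2 : ∏ c, (cnt (jw x y) c).factorial = PV := by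
      rw [Fintype.prod_prod_type]
      exact Finset.prod_congr rfl fun j _ => Finset.prod_congr rfl fun k _ => by rw [hy j k]
    have e3 : (Finset.univ.filter fun y' : Fin n → Fin K =>
        ∀ c, cnt (jw x y') c = cnt (jw x y) c) = S x := by
      simp only [hS]
      ext y'
      simp only [Finset.mem_filter, Finset.mem_univ, true_and, Prod.forall]
      exact forall_congr' fun j => forall_congr' fun k => by rw [hy j k]
    rw [e1, e2, e3] at h
    rw [div_le_iff₀ hPV', mul_comm]
    exact_mod_cast h
  set D : ℕ := ⌈(PT : ℝ) / PV⌉₊ with hD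
  have hDle : ∀ x ∈ X, D ≤ (S x).card := fun x hx => Nat.ceil_le.2 (hScard x hx)
  have hDge : (PT : ℝ) / PV ≤ D := Nat.le_ceil _
  have hD0 : (0 : ℝ) < D := lt_of_lt_of_le (by positivity) hDge
  have hx0X : x0 ∈ X := by simpa [hX] using hx0
  have hDL : D ≤ Ω.card := (hDle x0 hx0X).trans (Finset.card_le_card (hSΩ x0 hx0X))
  have hDL' : (D : ℝ) ≤ Ω.card := by exact_mod_cast hDL
  have hL0 : (0 : ℝ) < Ω.card := hD0.trans_le hDL'
  set r : ℝ := Ω.card / D with hr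
  have hr1 : 1 ≤ r := by rw [hr, le_div_iff₀ hD0]; linarith
  have hr0 : 0 < r := by linarith
  set M : ℕ := ⌈r * (n * J)⌉₊ + 1 with hM
  have hMlt : r * (n * J) < M := by
    have := Nat.le_ceil (r * (n * J))
    rw [hM]; push_cast; linarith
  have hMle : (M : ℝ) ≤ r * (n * J + 2) := by
    have h := (Nat.ceil_lt_add_one (a := r * (n * J)) (by positivity)).le
    rw [hM]; push_cast; nlinarith
  have hMcond : X.card * (Ω.card - D) ^ M < Ω.card ^ M := by
    have h1 : (X.card : ℝ) ≤ Real.exp (n * J) := by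
      have : X.card ≤ J ^ n := by
        refine (Finset.card_le_univ _).trans ?_
        simp
      calc (X.card : ℝ) ≤ (J : ℝ) ^ n := by exact_mod_cast this
        _ ≤ (Real.exp J) ^ n := by
          refine pow_le_pow_left₀ (by positivity) ?_ n
          have := Real.add_one_le_exp (J : ℝ); linarith
        _ = Real.exp (n * J) := by rw [← Real.exp_nat_mul]
    have h2 : ((Ω.card - D : ℕ) : ℝ) ≤ Ω.card * Real.exp (-(1 / r)) := by
      rw [Nat.cast_sub hDL]
      have := Real.add_one_le_exp (-(1 / r))
      have e : (Ω.card : ℝ) - D = Ω.card * (-(1 / r) + 1) := by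
        rw [hr]; field_simp; ring
      rw [e]
      exact mul_le_mul_of_nonneg_left this hL0.le
    have h3 : (X.card : ℝ) * ((Ω.card - D : ℕ) : ℝ) ^ M < (Ω.card : ℝ) ^ M := by
      calc (X.card : ℝ) * ((Ω.card - D : ℕ) : ℝ) ^ M
          ≤ Real.exp (n * J) * (Ω.card * Real.exp (-(1 / r))) ^ M := by
            gcongr
        _ = (Ω.card : ℝ) ^ M * Real.exp (n * J - M / r) := by
            rw [mul_pow, ← Real.exp_nat_mul, sub_eq_add_neg, Real.exp_add]
            have : (M : ℝ) * (-(1 / r)) = -(M / r) := by ring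
            rw [this]; ring
        _ < (Ω.card : ℝ) ^ M * 1 := by
            refine mul_lt_mul_of_pos_left ?_ (by positivity)
            rw [Real.exp_lt_one_iff, sub_neg, lt_div_iff₀ hr0]
            linarith
        _ = _ := mul_one _
    exact_mod_cast h3
  obtain ⟨c, hc⟩ := covering X Ω S D M hSΩ hDle hMcond
  refine ⟨M, c, ?_, ?_⟩
  · intro x hx
    obtain ⟨i, hi⟩ := hc x (by simpa [hX] using hx)
    exact ⟨i, by simpa [hS] using hi⟩
  · have hM0 : (0 : ℝ) < M := by rw [hM]; positivity
    have hlogM : Real.log M ≤ Real.log Ω.card - Real.log D + Real.log (n * J + 2) := by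
      have := Real.log_le_log hM0 hMle
      rwa [Real.log_mul hr0.ne' (by positivity), hr, Real.log_div hL0.ne' hD0.ne'] at this
    have hlogD : Real.log PT - Real.log PV ≤ Real.log D := by
      have := Real.log_le_log (by positivity) hDge
      rwa [Real.log_div hPT'.ne' hPV'.ne'] at this
    have hlogL : Real.log Ω.card + ∑ k, (s k : ℝ) * Real.log (s k) ≤ n * Real.log n := by
      have h : Ω.card * ∏ k, s k ^ s k ≤ n ^ n := by convert type_card s hssum
      have h' : (Ω.card : ℝ) * ∏ k, (s k : ℝ) ^ s k ≤ (n : ℝ) ^ n := by exact_mod_cast h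
      have hpos : ∀ k, (s k : ℝ) ^ s k ≠ 0 := by
        intro k
        rcases Nat.eq_zero_or_pos (s k) with h0 | h0
        · simp [h0]
        · have : (0 : ℝ) < s k := by exact_mod_cast h0
          positivity
      have hprod : (0 : ℝ) < ∏ k, (s k : ℝ) ^ s k :=
        Finset.prod_pos fun k _ => lt_of_le_of_ne (by positivity) (hpos k).symm
      have := Real.log_le_log (by positivity) h'
      rw [Real.log_mul hL0.ne' hprod.ne', Real.log_prod (fun k _ => hpos k), Real.log_pow] at this
      simpa [Real.log_pow] using this
    have hlogT : ∑ j, ((t j : ℝ) * Real.log (t j)) - n ≤ Real.log PT := by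
      rw [hPT]; push_cast
      rw [Real.log_prod (fun j _ => by exact_mod_cast (Nat.factorial_pos _).ne')]
      have : (n : ℝ) = ∑ j, (t j : ℝ) := by exact_mod_cast hsum.symm
      rw [this, ← Finset.sum_sub_distrib]
      exact Finset.sum_le_sum fun j _ => log_fact_lower (t j)
    have hlogV : Real.log PV ≤ ∑ j, ∑ k, ((V j k : ℝ) * Real.log (V j k)) - n
        + J * K * (2 * Real.log (n + 1) + 1) := by
      have e : (n : ℝ) = ∑ j, ∑ k, (V j k : ℝ) := by exact_mod_cast hsum.symm
      have e' : (J : ℝ) * K * (2 * Real.log (n + 1) + 1)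
          = ∑ j : Fin J, ∑ k : Fin K, (2 * Real.log ((n : ℝ) + 1) + 1) := by
        simp; ring
      have hle : ∀ j k, V j k ≤ n := by
        intro j k
        rw [← hsum]
        exact (Finset.single_le_sum (f := fun k => V j k) (fun _ _ => Nat.zero_le _)
          (Finset.mem_univ k)).trans (Finset.single_le_sum (f := fun j => ∑ k, V j k)
            (fun _ _ => Nat.zero_le _) (Finset.mem_univ j))
      have h1 : Real.log PV ≤ ∑ j, ∑ k, ((V j k : ℝ) * Real.log (V j k) - V j k
          + (2 * Real.log (n + 1) + 1)) := by
        rw [hPV]; push_cast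
        rw [Real.log_prod (fun j _ => Finset.prod_ne_zero_iff.2 fun k _ => by
          exact_mod_cast (Nat.factorial_pos _).ne')]
        refine Finset.sum_le_sum fun j _ => ?_
        rw [Real.log_prod (fun k _ => by exact_mod_cast (Nat.factorial_pos _).ne')]
        refine Finset.sum_le_sum fun k _ => ?_
        have h2 := log_fact_upper (V j k)
        have h3 : Real.log ((V j k : ℝ) + 1) ≤ Real.log (n + 1) := by
          have : (V j k : ℝ) ≤ n := by exact_mod_cast hle j k
          exact Real.log_le_log (by positivity) (by linarith)
        linarith
      simp only [Finset.sum_add_distrib, Finset.sum_sub_distrib] at h1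
      rw [← e] at h1
      rw [e']
      simp only [Finset.sum_add_distrib] at h1 ⊢
      exact h1
    unfold FF
    have es : ∀ k, ∑ j, (V j k : ℝ) = (s k : ℝ) := fun k => by rw [hs]; push_cast; rfl
    have et : ∀ j, ∑ k, (V j k : ℝ) = (t j : ℝ) := fun j => by rw [ht]; push_cast; rfl
    simp only [es, et]
    linarith

lemma codebook {J K n : ℕ} (hn : 0 < n) (hK : 0 < K) :
    ∃ Y : ℕ → (Fin n → Fin K), ∀ (x : Fin n → Fin J) (V : Fin J → Fin K → ℕ),
      (∀ j, ∑ k, V j k = cnt x j) →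
      ∃ m : ℕ, (∀ j k, cnt (jw x (Y m)) (j, k) = V j k) ∧
        Real.log (m + 1) ≤ FF n (fun j k => (V j k : ℝ)) + J * K * (2 * Real.log (n + 1) + 1)
          + Real.log (n * J + 2) + J * K * Real.log (n + 1) := by
  classical
  have h1 : ∀ V : Fin J → Fin K → Fin (n + 1), ∃ c : ℕ → (Fin n → Fin K),
      ∀ x : Fin n → Fin J, (∀ j, ∑ k, (V j k : ℕ) = cnt x j) →
        ∃ i : ℕ, (∀ j k, cnt (jw x (c i)) (j, k) = V j k) ∧
      Real.log (i + 1) ≤ FF n (fun j k => ((V j k : ℕ) : ℝ)) + J * K * (2 * Real.log (n + 1) + 1)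
        + Real.log (n * J + 2) := by
    intro V
    by_cases hx : ∃ x0 : Fin n → Fin J, ∀ j, ∑ k, (V j k : ℕ) = cnt x0 j
    · obtain ⟨x0, hx0⟩ := hx
      obtain ⟨M, c, hc, hM⟩ := cover_V hn (fun j k => (V j k : ℕ)) x0 hx0
      refine ⟨fun i => if h : i < M then c ⟨i, h⟩ else fun _ => ⟨0, hK⟩, fun x hx => ?_⟩
      obtain ⟨i, hi⟩ := hc x hx
      refine ⟨i, ?_, ?_⟩
      · simpa using hi
      · refine le_trans (Real.log_le_log (by positivity) ?_) hM
        have := i.2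
        exact_mod_cast this
    · exact ⟨fun _ _ => ⟨0, hK⟩, fun x hx' => absurd ⟨x, hx'⟩ hx⟩
  choose c hc using h1
  set P := Fintype.card (Fin J → Fin K → Fin (n + 1)) with hP
  have hP0 : 0 < P := Fintype.card_pos
  let e : (Fin J → Fin K → Fin (n + 1)) ≃ Fin P := Fintype.equivFin _
  refine ⟨fun m => c (e.symm ⟨m % P, Nat.mod_lt _ hP0⟩) (m / P), fun x V hV => ?_⟩
  have hle : ∀ j k, V j k < n + 1 := by
    intro j k
    have h1 : V j k ≤ cnt x j := by
      rw [← hV j]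
      exact Finset.single_le_sum (f := fun k => V j k) (fun _ _ => Nat.zero_le _)
          (Finset.mem_univ k)
    have h2 : cnt x j ≤ n := (Finset.card_le_univ _).trans (by simp)
    omega
  let V' : Fin J → Fin K → Fin (n + 1) := fun j k => ⟨V j k, hle j k⟩
  obtain ⟨i, hi, hlog⟩ := hc V' x hV
  refine ⟨P * i + e V', ?_, ?_⟩
  · have e1 : (P * i + (e V' : ℕ)) / P = i := by
      rw [Nat.mul_add_div hP0, Nat.div_eq_of_lt (e V').2, add_zero]
    have e2 : (P * i + (e V' : ℕ)) % P = e V' := by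
      rw [Nat.mul_add_mod, Nat.mod_eq_of_lt (e V').2]
    have e3 : e.symm ⟨(P * i + (e V' : ℕ)) % P, Nat.mod_lt _ hP0⟩ = V' := by
      rw [Equiv.symm_apply_eq]; exact Fin.ext e2
    intro j k
    simp only [e3, e1]
    exact hi j k
  · have hP' : (0 : ℝ) < P := by exact_mod_cast hP0
    have b1 : ((P * i + (e V' : ℕ) : ℕ) : ℝ) + 1 ≤ P * (i + 1) := by
      have h := (e V').2
      have : P * i + (e V' : ℕ) + 1 ≤ P * (i + 1) := by rw [mul_add]; omega
      exact_mod_cast this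
    have b2 : Real.log P = J * K * Real.log (n + 1) := by
      have : P = ((n + 1) ^ K) ^ J := by simp [hP]
      rw [this]; push_cast
      rw [Real.log_pow, Real.log_pow]; ring
    have b3 := Real.log_le_log (by positivity) b1
    rw [Real.log_mul hP'.ne' (by positivity), b2] at b3
    have hlog' : Real.log ((i : ℝ) + 1) ≤ FF n (fun j k => (V j k : ℝ))
        + J * K * (2 * Real.log (n + 1) + 1) + Real.log (n * J + 2) := hlog
    linarith

lemma h_diff {a b n : ℝ} (ha : 0 ≤ a) (hb : 0 ≤ b) (han : a ≤ n) (hn : 1 ≤ n) :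
    a * Real.log a - b * Real.log b ≤ |a - b| * (1 + Real.log n) + 1 := by
  have hln : 0 ≤ Real.log n := Real.log_nonneg hn
  have hneg : -(b * Real.log b) ≤ 1 := by
    rcases hb.eq_or_lt with rfl | hb'
    · simp
    have h := Real.one_sub_inv_le_log_of_pos hb'
    have h2 := mul_le_mul_of_nonneg_left h hb
    rw [mul_sub, mul_inv_cancel₀ hb'.ne'] at h2
    linarith
  have hab0 : 0 ≤ |a - b| * (1 + Real.log n) := by positivity
  rcases le_total b a with hab | hab
  · rw [abs_of_nonneg (by linarith)]
    rcases hb.eq_or_lt with rfl | hb'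
    · rcases ha.eq_or_lt with rfl | ha'
      · simp
      have := Real.log_le_log ha' han
      simp only [sub_zero, zero_mul]
      nlinarith
    · have ha' : 0 < a := by linarith
      have h := Real.log_le_sub_one_of_pos (show 0 < a / b by positivity)
      rw [Real.log_div ha'.ne' hb'.ne'] at h
      have h2 := mul_le_mul_of_nonneg_left h hb'.le
      have e : b * (a / b - 1) = a - b := by field_simp
      have h3 := mul_le_mul_of_nonneg_left (Real.log_le_log ha' han) (show 0 ≤ a - b by linarith)
      rw [e] at h2
      nlinarith
  · rcases le_total a 1 with h1 | h1
    · have : a * Real.log a ≤ 0 := mul_nonpos_of_nonneg_of_nonpos ha (Real.log_nonpos ha h1)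
      linarith
    · have h2 := Real.log_le_log (by linarith) hab
      have h3 : 0 ≤ Real.log a := Real.log_nonneg h1
      have : a * Real.log a ≤ b * Real.log b := mul_le_mul hab h2 h3 hb
      linarith

lemma FF_eq {J K n : ℕ} (hn : 0 < n) (T : Fin J → ℕ) (hT : ∑ j, T j = n)
    (Q : Fin J → Fin K → ℝ) (hQ : IsCondProb Q) :
    FF n (fun j k => (T j : ℝ) * Q j k) = n * mutualInfo (fun j => (T j : ℝ) / n) Q := by
  have hn' : (0 : ℝ) < n := by exact_mod_cast hn
  have hrow : ∀ j, ∑ k, (T j : ℝ) * Q j k = T j := fun j => by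
    rw [← Finset.mul_sum, (hQ j).2, mul_one]
  have hW0 : ∀ j k, 0 ≤ (T j : ℝ) * Q j k := fun j k =>
    mul_nonneg (by positivity) ((hQ j).1 k)
  unfold FF mutualInfo
  simp only [hrow]
  have e1 : (n : ℝ) * Real.log n = ∑ j, ∑ k, (T j : ℝ) * Q j k * Real.log n := by
    simp only [← Finset.sum_mul, hrow]
    congr 1
    exact_mod_cast hT.symm
  have e2 : ∑ j, (T j : ℝ) * Real.log (T j) = ∑ j, ∑ k, (T j : ℝ) * Q j k * Real.log (T j) := by
    simp only [← Finset.sum_mul, hrow]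
  have e3 : ∑ k, (∑ j, (T j : ℝ) * Q j k) * Real.log (∑ j, (T j : ℝ) * Q j k)
      = ∑ j, ∑ k, (T j : ℝ) * Q j k * Real.log (∑ j, (T j : ℝ) * Q j k) := by
    rw [Finset.sum_comm]
    simp only [← Finset.sum_mul]
  rw [e1, e2, e3, ← Finset.sum_add_distrib, ← Finset.sum_sub_distrib, ← Finset.sum_sub_distrib,
    Finset.mul_sum]
  refine Finset.sum_congr rfl fun j _ => ?_
  rw [← Finset.sum_add_distrib, ← Finset.sum_sub_distrib, ← Finset.sum_sub_distrib,
    Finset.mul_sum]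
  refine Finset.sum_congr rfl fun k _ => ?_
  have e4 : ∑ j', (T j' : ℝ) / n * Q j' k = (∑ j', (T j' : ℝ) * Q j' k) / n := by
    rw [Finset.sum_div]; exact Finset.sum_congr rfl fun _ _ => by ring
  rw [e4]
  rcases (hW0 j k).eq_or_lt with h0 | h0
  · have h0' : (T j : ℝ) / n * Q j k = 0 := by
      rw [div_mul_eq_mul_div, ← h0, zero_div]
    rw [← h0, h0']; simp
  · have hs : 0 < ∑ j', (T j' : ℝ) * Q j' k :=
      h0.trans_le (Finset.single_le_sum (f := fun j' => (T j' : ℝ) * Q j' k)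
        (fun j' _ => hW0 j' k) (Finset.mem_univ j))
    have hTj : (0 : ℝ) < T j := by
      rcases Nat.eq_zero_or_pos (T j) with h | h
      · simp [h] at h0
      · exact_mod_cast h
    have hq : 0 < Q j k := by
      rcases ((hQ j).1 k).eq_or_lt with h | h
      · rw [← h] at h0; simp at h0
      · exact h
    rw [Real.log_div hq.ne' (by positivity), Real.log_div hs.ne' hn'.ne', Real.log_mul hTj.ne' hq.ne']
    field_simp
    ring

lemma rounding {J K n : ℕ} (hn : 0 < n) (T : Fin J → ℕ) (hT : ∑ j, T j = n)
    (Q : Fin J → Fin K → ℝ) (hQ : IsCondProb Q) (ρmax : ℝ) (ρ : Fin J → Fin K → ℝ)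
    (hρ : IsDistMeasure ρmax ρ) :
    ∃ V : Fin J → Fin K → ℕ, (∀ j, ∑ k, V j k = T j) ∧
      (∑ j, ∑ k, (V j k : ℝ) * ρ j k ≤ ∑ j, ∑ k, (T j : ℝ) * Q j k * ρ j k) ∧
      FF n (fun j k => (V j k : ℝ)) ≤ FF n (fun j k => (T j : ℝ) * Q j k)
        + (J * K * (K + 1) + K * (J * K + 1)) * (1 + Real.log n) := by
  classical
  have hn' : (1 : ℝ) ≤ n := by exact_mod_cast hn
  have hln : 0 ≤ Real.log n := Real.log_nonneg hn'
  choose k0 hk0 using hρ.2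
  set W : Fin J → Fin K → ℝ := fun j k => (T j : ℝ) * Q j k with hW
  have hrow : ∀ j, ∑ k, W j k = T j := fun j => by
    simp only [hW]; rw [← Finset.mul_sum, (hQ j).2, mul_one]
  have hW0 : ∀ j k, 0 ≤ W j k := fun j k => mul_nonneg (by positivity) ((hQ j).1 k)
  set R : Fin J → ℕ := fun j => ∑ k ∈ Finset.univ.erase (k0 j), ⌊W j k⌋₊ with hR
  have hWsplit : ∀ j, W j (k0 j) + ∑ k ∈ Finset.univ.erase (k0 j), W j k = T j := fun j => by
    rw [Finset.add_sum_erase _ _ (Finset.mem_univ _), hrow]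
  have hRle' : ∀ j, (R j : ℝ) ≤ ∑ k ∈ Finset.univ.erase (k0 j), W j k := fun j => by
    rw [hR]; push_cast
    exact Finset.sum_le_sum fun k _ => Nat.floor_le (hW0 j k)
  have hRge : ∀ j, ∑ k ∈ Finset.univ.erase (k0 j), W j k ≤ R j + K := fun j => by
    have h1 : ∑ k ∈ Finset.univ.erase (k0 j), W j k
        ≤ ∑ k ∈ Finset.univ.erase (k0 j), ((⌊W j k⌋₊ : ℝ) + 1) :=
      Finset.sum_le_sum fun k _ => (Nat.lt_floor_add_one _).le
    rw [Finset.sum_add_distrib, Finset.sum_const, nsmul_eq_mul, mul_one] at h1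
    have h2 : ((Finset.univ.erase (k0 j)).card : ℝ) ≤ K := by
      have := Finset.card_le_univ (Finset.univ.erase (k0 j))
      rw [Fintype.card_fin] at this
      exact_mod_cast this
    rw [hR]; push_cast
    linarith
  have hRle : ∀ j, R j ≤ T j := fun j => by
    have : (R j : ℝ) ≤ T j := by linarith [hRle' j, hWsplit j, hW0 j (k0 j)]
    exact_mod_cast this
  set V : Fin J → Fin K → ℕ := fun j k => if k = k0 j then T j - R j else ⌊W j k⌋₊ with hV
  have hV0 : ∀ j, V j (k0 j) = T j - R j := fun j => by simp [hV]
  have hV1 : ∀ j k, k ≠ k0 j → V j k = ⌊W j k⌋₊ := fun j k h => by simp [hV, h]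
  have hVrow : ∀ j, ∑ k, V j k = T j := fun j => by
    rw [← Finset.add_sum_erase _ _ (Finset.mem_univ (k0 j)), hV0,
      Finset.sum_congr rfl (fun k hk => hV1 j k (Finset.ne_of_mem_erase hk))]
    have := hRle j
    simp only [hR] at this ⊢
    omega
  have hTn : ∀ j, (T j : ℝ) ≤ n := fun j => by
    rw [← hT]
    exact_mod_cast Finset.single_le_sum (f := T) (fun _ _ => Nat.zero_le _) (Finset.mem_univ j)
  have hVn : ∀ j k, (V j k : ℝ) ≤ n := fun j k => by
    refine le_trans ?_ (hTn j)
    rw [← hVrow j]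
    exact_mod_cast Finset.single_le_sum (f := V j) (fun _ _ => Nat.zero_le _) (Finset.mem_univ k)
  have hK1 : ∀ _ : Fin K, (1 : ℝ) ≤ K := fun k => by
    have := k.pos
    exact_mod_cast this
  have hdiff : ∀ j k, |(V j k : ℝ) - W j k| ≤ K := fun j k => by
    by_cases hk : k = k0 j
    · subst hk
      rw [hV0, Nat.cast_sub (hRle j), abs_le]
      constructor <;> linarith [hRle' j, hRge j, hWsplit j, hK1 (k0 j)]
    · rw [hV1 j k hk, abs_le]
      constructor <;>
        linarith [Nat.floor_le (hW0 j k), (Nat.lt_floor_add_one (W j k)).le, hK1 k]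
  refine ⟨V, hVrow, ?_, ?_⟩
  · refine Finset.sum_le_sum fun j _ => Finset.sum_le_sum fun k _ => ?_
    by_cases hk : k = k0 j
    · subst hk; simp [hk0]
    · rw [hV1 j k hk]
      exact mul_le_mul_of_nonneg_right (Nat.floor_le (hW0 j k)) (hρ.1 j k).1
  · have hVrow' : ∀ j, ∑ k, (V j k : ℝ) = T j := fun j => by exact_mod_cast hVrow j
    have a1 : ∑ j, ∑ k, ((V j k : ℝ) * Real.log (V j k) - W j k * Real.log (W j k))
        ≤ ∑ j : Fin J, ∑ k : Fin K, ((K : ℝ) * (1 + Real.log n) + 1) := by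
      refine Finset.sum_le_sum fun j _ => Finset.sum_le_sum fun k _ => ?_
      refine (h_diff (by positivity) (hW0 j k) (hVn j k) hn').trans ?_
      have := mul_le_mul_of_nonneg_right (hdiff j k) (show 0 ≤ 1 + Real.log n by linarith)
      linarith
    have a2 : ∑ k, ((∑ j, W j k) * Real.log (∑ j, W j k)
          - (∑ j, (V j k : ℝ)) * Real.log (∑ j, (V j k : ℝ)))
        ≤ ∑ k : Fin K, (((J : ℝ) * K) * (1 + Real.log n) + 1) := by
      refine Finset.sum_le_sum fun k _ => ?_
      have b1 : ∑ j, W j k ≤ n := by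
        have : (n : ℝ) = ∑ j, (T j : ℝ) := by exact_mod_cast hT.symm
        rw [this]
        refine Finset.sum_le_sum fun j _ => ?_
        rw [← hrow j]
        exact Finset.single_le_sum (f := fun k => W j k) (fun k _ => hW0 j k) (Finset.mem_univ k)
      refine (h_diff (Finset.sum_nonneg fun j _ => hW0 j k)
        (Finset.sum_nonneg fun j _ => by positivity) b1 hn').trans ?_
      have b2 : |∑ j, W j k - ∑ j, (V j k : ℝ)| ≤ J * K := by
        rw [← Finset.sum_sub_distrib]
        refine (Finset.abs_sum_le_sum_abs _ _).trans ?_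
        refine (Finset.sum_le_sum (g := fun _ => (K : ℝ)) fun j _ => ?_).trans (by simp)
        rw [abs_sub_comm]; exact hdiff j k
      have := mul_le_mul_of_nonneg_right b2 (show 0 ≤ 1 + Real.log n by linarith)
      linarith
    simp only [Finset.sum_sub_distrib] at a1 a2
    simp only [Finset.sum_const, Finset.card_univ, Fintype.card_fin, nsmul_eq_mul] at a1 a2
    unfold FF
    simp only [hVrow', hrow]
    have hJK : (0 : ℝ) ≤ J * K * Real.log n := by positivity
    have hKl : (0 : ℝ) ≤ K * Real.log n := by positivity
    nlinarith

lemma sum_jw {J K n : ℕ} (ρ : Fin J → Fin K → ℝ) (x : Fin n → Fin J) (y : Fin n → Fin K) :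
    ∑ i, ρ (x i) (y i) = ∑ j, ∑ k, (cnt (jw x y) (j, k) : ℝ) * ρ j k := by
  have h := Finset.sum_fiberwise' Finset.univ (jw x y) (fun c => ρ c.1 c.2)
  rw [Fintype.sum_prod_type] at h
  have e : ∑ i, ρ (x i) (y i) = ∑ i, ρ (jw x y i).1 (jw x y i).2 := rfl
  rw [e, ← h]
  refine Finset.sum_congr rfl fun j _ => Finset.sum_congr rfl fun k _ => ?_
  rw [Finset.sum_const, nsmul_eq_mul]; rfl

lemma exists_index {J K : ℕ} (hK : 0 < K) :
    ∃ C : ℝ, 0 ≤ C ∧ ∀ n : ℕ, 0 < n → ∃ Y : ℕ → (Fin n → Fin K),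
      ∀ (ρmax d : ℝ), 0 < d → ∀ (x : Fin n → Fin J) (ρ : Fin J → Fin K → ℝ),
        IsDistMeasure ρmax ρ → ∃ m : ℕ, nDist ρ x (Y m) ≤ d ∧
          Real.log (m + 1) ≤ n * RD (typeOf x) d ρ + C * (1 + Real.log n) := by
  refine ⟨(J * K * (K + 1) + K * (J * K + 1)) + (4 * J * K + J + 2) + 1, by positivity,
    fun n hn => ?_⟩
  have hn' : (1 : ℝ) ≤ n := by exact_mod_cast hn
  have hn0 : (0 : ℝ) < n := by linarith
  have hln : 0 ≤ Real.log n := Real.log_nonneg hn'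
  obtain ⟨Y, hY⟩ := codebook (J := J) hn hK
  refine ⟨Y, fun ρmax d hd x ρ hρ => ?_⟩
  have hne : { r | ∃ Q, IsCondProb Q ∧ avgDist (typeOf x) Q ρ ≤ d ∧
      r = mutualInfo (typeOf x) Q }.Nonempty := by
    choose k0 hk0 using hρ.2
    refine ⟨_, fun j k => if k = k0 j then 1 else 0, ?_, ?_, rfl⟩
    · intro j
      refine ⟨fun k => ?_, ?_⟩
      · dsimp only; split_ifs <;> norm_num
      · simp
    · have : avgDist (typeOf x) (fun j k => if k = k0 j then 1 else 0) ρ = 0 := by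
        unfold avgDist
        refine Finset.sum_eq_zero fun j _ => Finset.sum_eq_zero fun k _ => ?_
        by_cases hk : k = k0 j
        · subst hk; simp [hk0]
        · simp [hk]
      rw [this]; exact hd.le
  obtain ⟨_, ⟨Q, hQ, hQd, rfl⟩, hlt⟩ := exists_lt_of_csInf_lt hne
    (show sInf _ < RD (typeOf x) d ρ + 1 / n by
      unfold RD; exact lt_add_of_pos_right _ (by positivity))
  obtain ⟨V, hVrow, hVd, hVF⟩ := rounding hn (cnt x) (sum_cnt x) Q hQ ρmax ρ hρ
  obtain ⟨m, hm, hlog⟩ := hY x V hVrow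
  refine ⟨m, ?_, ?_⟩
  · unfold nDist
    rw [div_le_iff₀ hn0, sum_jw]
    simp only [hm]
    refine hVd.trans ?_
    have e : ∑ j, ∑ k, (cnt x j : ℝ) * Q j k * ρ j k = avgDist (typeOf x) Q ρ * n := by
      unfold avgDist
      rw [Finset.sum_mul]
      refine Finset.sum_congr rfl fun j _ => ?_
      rw [Finset.sum_mul]
      refine Finset.sum_congr rfl fun k _ => ?_
      have : typeOf x j = (cnt x j : ℝ) / n := rfl
      rw [this]; field_simp
    rw [e]
    exact mul_le_mul_of_nonneg_right hQd hn0.le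
  · rw [FF_eq hn (cnt x) (sum_cnt x) Q hQ] at hVF
    have e : (fun j => (cnt x j : ℝ) / n) = typeOf x := rfl
    rw [e] at hVF
    have h1 : (n : ℝ) * mutualInfo (typeOf x) Q ≤ n * RD (typeOf x) d ρ + 1 := by
      have := mul_le_mul_of_nonneg_left hlt.le hn0.le
      rw [mul_add, mul_one_div_cancel hn0.ne'] at this
      exact this
    have h2 : Real.log ((n : ℝ) + 1) ≤ Real.log n + 1 := by
      have h := Real.log_le_log (by positivity) (show (n : ℝ) + 1 ≤ n * 2 by linarith)
      rw [Real.log_mul hn0.ne' (by norm_num)] at h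
      have := Real.log_two_lt_d9
      linarith
    have h3 : Real.log ((n : ℝ) * J + 2) ≤ Real.log n + (J + 1) := by
      have h := Real.log_le_log (by positivity) (show (n : ℝ) * J + 2 ≤ n * (J + 2) by nlinarith)
      rw [Real.log_mul hn0.ne' (by positivity)] at h
      have := Real.log_le_sub_one_of_pos (show (0 : ℝ) < J + 2 by positivity)
      linarith
    have hJK : (0 : ℝ) ≤ J * K := by positivity
    have h4 := mul_le_mul_of_nonneg_left h2 hJK
    have h5 : (0 : ℝ) ≤ J * K * Real.log n := by positivity
    have h6 : (0 : ℝ) ≤ J * Real.log n := by positivity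
    nlinarith

lemma length_bits (m : ℕ) : Real.log 2 * ((Nat.bits m).length : ℝ) ≤ Real.log (m + 1) + 1 := by
  rw [Nat.size_eq_bits_len]
  rcases Nat.eq_zero_or_pos m with rfl | hm
  · simp
  have hs : 0 < Nat.size m := Nat.size_pos.2 hm
  have h : 2 ^ (Nat.size m - 1) ≤ m := Nat.lt_size.1 (by omega)
  have h' : (2 : ℝ) ^ (Nat.size m - 1) ≤ (m : ℝ) + 1 := by
    have : (2 : ℝ) ^ (Nat.size m - 1) ≤ (m : ℝ) := by exact_mod_cast h
    linarith
  have := Real.log_le_log (by positivity) h'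
  rw [Real.log_pow, Nat.cast_sub hs] at this
  have := Real.log_two_lt_d9
  push_cast at *
  linarith

lemma sum_prodProb {J n : ℕ} (p : Fin J → ℝ) (hp : IsProb p) :
    ∑ x : Fin n → Fin J, prodProb p x = 1 := by
  have h := Finset.prod_univ_sum (fun _ : Fin n => (Finset.univ : Finset (Fin J))) (fun _ k => p k)
  rw [Finset.prod_const, hp.2, one_pow, Fintype.piFinset_univ] at h
  exact h.symm

/-- Theorem 3: there is a constant `c` depending only on `J` and `K`
(the `O(1/n)` term) such that for every `ρmax > 0` and `d > 0`, for sufficiently large `n`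
there is a *deterministic non-prefix* `d`-semifaithful code in the universal distortion
setting whose expected rate exceeds `E_p[R(T,d,ρ)]` by at most the stated bound,
uniformly over all sources `p` and distortion measures `ρ ∈ D`,
where `γ_n = 1 + ln(J²K² + J − 1)/ln ln n`. -/
theorem deterministic_nonprefix_universal_code (J K : ℕ) (hJ : 0 < J) (hK : 0 < K) :
    ∃ c : ℝ, ∀ ρmax d : ℝ, 0 < ρmax → 0 < d →
    ∃ N : ℕ, ∀ n : ℕ, N ≤ n →
      ∃ (φ : (Fin n → Fin J) → (Fin J → Fin K → ℝ) → (Fin n → Fin K))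
        (f : (Fin n → Fin K) → List Bool)
        (g : List Bool → (Fin n → Fin K)),
        -- d-semifaithful for every sequence and every ρ ∈ D
        (∀ x ρ, IsDistMeasure ρmax ρ → nDist ρ x (φ x ρ) ≤ d) ∧
        -- lossless binary encoder/decoder pair on the codebook
        (∀ x ρ, IsDistMeasure ρmax ρ → g (f (φ x ρ)) = φ x ρ) ∧
        -- uniform expected-rate bound
        (∀ (p : Fin J → ℝ), IsProb p → ∀ ρ : Fin J → Fin K → ℝ, IsDistMeasure ρmax ρ →
          (1 / (n : ℝ)) * (∑ x : Fin n → Fin J, prodProb p x *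
              (Real.log 2 * ((f (φ x ρ)).length : ℝ)))
            - expTypeRD n p d ρ
          ≤ 2 * ρmax * Real.log n / (d * (n : ℝ) ^ ((5 : ℝ) / 8))
            + 4 * ρmax * (min (Real.log K) (Real.log J) + Real.log 2)
                / (d * (n : ℝ) ^ ((5 : ℝ) / 8))
            + (((K : ℝ) + 5 / 4) / 2) * (Real.log n / n)
            + (1 + Real.log ((J : ℝ) ^ 2 * (K : ℝ) ^ 2 + (J : ℝ) - 1) / Real.log (Real.log n))
                * (Real.log (Real.log n) / n)
            + c / n) := by
  obtain ⟨C, hC0, hC⟩ := exists_index (J := J) (K := K) hK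
  refine ⟨0, fun ρmax d hρmax hd => ?_⟩
  have htend : ∀ᶠ n : ℕ in atTop, (C + 1) * d / ρmax ≤ (n : ℝ) ^ ((3 : ℝ) / 8) :=
    ((tendsto_rpow_atTop (by norm_num)).comp tendsto_natCast_atTop_atTop).eventually_ge_atTop _
  obtain ⟨N, hN⟩ := eventually_atTop.1 htend
  refine ⟨max N 3, fun n hn => ?_⟩
  have hnN : N ≤ n := (le_max_left _ _).trans hn
  have hn3 : 3 ≤ n := (le_max_right _ _).trans hn
  have hn3' : (3 : ℝ) ≤ n := by exact_mod_cast hn3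
  have hn0 : (0 : ℝ) < n := by linarith
  obtain ⟨Y, hY⟩ := hC n (by omega)
  have hY' : ∀ (x : Fin n → Fin J) (ρ : Fin J → Fin K → ℝ), ∃ m : ℕ, IsDistMeasure ρmax ρ →
      nDist ρ x (Y m) ≤ d ∧
          Real.log (m + 1) ≤ n * RD (typeOf x) d ρ + C * (1 + Real.log n) := by
    intro x ρ
    by_cases h : IsDistMeasure ρmax ρ
    · obtain ⟨m, hm⟩ := hY ρmax d hd x ρ h
      exact ⟨m, fun _ => hm⟩
    · exact ⟨0, fun h' => absurd h' h⟩
  choose μ hμ using hY'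
  have hinj : Function.Injective Nat.bits := by
    intro a b h
    have key : ∀ m : ℕ, List.foldr Nat.bit 0 (Nat.bits m) = m := by
      intro m
      induction m using Nat.binaryRec' with
      | zero => simp
      | bit b m hm ih => rw [Nat.bits_append_bit m b hm, List.foldr_cons, ih]
    rw [← key a, h, key b]
  refine ⟨fun x ρ => Y (μ x ρ), fun y => Nat.bits (sInf {m | Y m = y}),
    fun l => Y (Function.invFun Nat.bits l), fun x ρ hρ => (hμ x ρ hρ).1, fun x ρ _ => ?_, ?_⟩
  · show Y (Function.invFun Nat.bits (Nat.bits (sInf {m | Y m = Y (μ x ρ)}))) = Y (μ x ρ)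
    rw [Function.leftInverse_invFun hinj]
    exact Nat.sInf_mem (s := {m | Y m = Y (μ x ρ)}) ⟨μ x ρ, rfl⟩
  intro p hp ρ hρ
  have hlog1 : 1 ≤ Real.log n := by
    rw [Real.le_log_iff_exp_le hn0]
    linarith [Real.exp_one_lt_d9]
  have hpp : ∀ x : Fin n → Fin J, 0 ≤ prodProb p x := fun x => Finset.prod_nonneg fun i _ => hp.1 _
  have hlen : ∀ x : Fin n → Fin J,
      Real.log 2 * ((Nat.bits (sInf {m | Y m = Y (μ x ρ)})).length : ℝ)
        ≤ n * RD (typeOf x) d ρ + (C + 1) * (1 + Real.log n) := by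
    intro x
    have h1 := length_bits (sInf {m | Y m = Y (μ x ρ)})
    have h2 : sInf {m | Y m = Y (μ x ρ)} ≤ μ x ρ := Nat.sInf_le rfl
    have h3 : Real.log (((sInf {m | Y m = Y (μ x ρ)} : ℕ) : ℝ) + 1) ≤ Real.log ((μ x ρ : ℝ) + 1) := by
      refine Real.log_le_log (by positivity) ?_
      exact_mod_cast Nat.succ_le_succ h2
    have h4 := (hμ x ρ hρ).2
    linarith
  have hmain : (1 / (n : ℝ)) * (∑ x : Fin n → Fin J, prodProb p x *
      (Real.log 2 * ((Nat.bits (sInf {m | Y m = Y (μ x ρ)})).length : ℝ))) - expTypeRD n p d ρ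
      ≤ (C + 1) * (1 + Real.log n) / n := by
    have h1 : ∑ x : Fin n → Fin J, prodProb p x *
        (Real.log 2 * ((Nat.bits (sInf {m | Y m = Y (μ x ρ)})).length : ℝ))
        ≤ ∑ x : Fin n → Fin J, prodProb p x *
          (n * RD (typeOf x) d ρ + (C + 1) * (1 + Real.log n)) :=
      Finset.sum_le_sum fun x _ => mul_le_mul_of_nonneg_left (hlen x) (hpp x)
    have h2 : ∑ x : Fin n → Fin J, prodProb p x *
          (n * RD (typeOf x) d ρ + (C + 1) * (1 + Real.log n))
        = n * expTypeRD n p d ρ + (C + 1) * (1 + Real.log n) := by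
      simp only [mul_add (prodProb p _)]
      rw [Finset.sum_add_distrib, ← Finset.sum_mul, sum_prodProb p hp, one_mul]
      unfold expTypeRD
      rw [Finset.mul_sum]
      congr 1
      exact Finset.sum_congr rfl fun x _ => by ring
    rw [h2] at h1
    have h3 := mul_le_mul_of_nonneg_left h1 (show 0 ≤ 1 / (n : ℝ) by positivity)
    have h4 : 1 / (n : ℝ) * (n * expTypeRD n p d ρ + (C + 1) * (1 + Real.log n))
        = expTypeRD n p d ρ + (C + 1) * (1 + Real.log n) / n := by
      field_simp
    linarith
  have hpow : (n : ℝ) ^ ((5 : ℝ) / 8) * (n : ℝ) ^ ((3 : ℝ) / 8) = n := by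
    rw [← Real.rpow_add hn0]; norm_num
  have h58 : 0 < (n : ℝ) ^ ((5 : ℝ) / 8) := by positivity
  have hA : (C + 1) * (1 + Real.log n) / n
      ≤ 2 * ρmax * Real.log n / (d * (n : ℝ) ^ ((5 : ℝ) / 8)) := by
    have h := hN n hnN
    rw [div_le_iff₀ hρmax] at h
    rw [div_le_div_iff₀ hn0 (by positivity)]
    have h1 := mul_le_mul_of_nonneg_right h h58.le
    have h2 : (n : ℝ) ^ ((3 : ℝ) / 8) * ρmax * (n : ℝ) ^ ((5 : ℝ) / 8) = n * ρmax := by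
      calc _ = (n : ℝ) ^ ((5 : ℝ) / 8) * (n : ℝ) ^ ((3 : ℝ) / 8) * ρmax := by ring
        _ = _ := by rw [hpow]
    rw [h2] at h1
    have h3 := mul_le_mul_of_nonneg_right h1 (show 0 ≤ 2 * Real.log n by linarith)
    have h4 : 0 ≤ (C + 1) * (d * (n : ℝ) ^ ((5 : ℝ) / 8)) := by positivity
    have h5 := mul_le_mul_of_nonneg_left (show 1 + Real.log n ≤ 2 * Real.log n by linarith) h4
    linarith
  have hJ1 : (1 : ℝ) ≤ J := by exact_mod_cast hJ
  have hK1 : (1 : ℝ) ≤ K := by exact_mod_cast hK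
  have hB : 0 ≤ 4 * ρmax * (min (Real.log K) (Real.log J) + Real.log 2)
                / (d * (n : ℝ) ^ ((5 : ℝ) / 8)) := by
    have h1 : 0 ≤ min (Real.log K) (Real.log J) := le_min (Real.log_nonneg hK1) (Real.log_nonneg hJ1)
    have h2 : 0 ≤ Real.log 2 := Real.log_nonneg (by norm_num)
    positivity
  have hlog0 : 0 ≤ Real.log n := by linarith
  have hD : 0 ≤ (((K : ℝ) + 5 / 4) / 2) * (Real.log n / n) := by positivity
  have hE : 0 ≤ (1 + Real.log ((J : ℝ) ^ 2 * (K : ℝ) ^ 2 + (J : ℝ) - 1) / Real.log (Real.log n))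
                * (Real.log (Real.log n) / n) := by
    have h1 : 0 ≤ Real.log (Real.log n) := Real.log_nonneg hlog1
    have h2 : 0 ≤ Real.log ((J : ℝ) ^ 2 * (K : ℝ) ^ 2 + (J : ℝ) - 1) := by
      refine Real.log_nonneg ?_
      have : 1 ≤ (J : ℝ) ^ 2 * (K : ℝ) ^ 2 := one_le_mul_of_one_le_of_one_le
        (one_le_pow₀ hJ1) (one_le_pow₀ hK1)
      linarith
    positivity
  have hF : (0 : ℝ) / n = 0 := zero_div _
  rw [hF]
  linarith
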